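/- Let G be a connected d-regular finite simple graph on a vertex set V with |V| ≥ 2, with adjacency matrix A(G), and let λ₂(G) = max{ ⟨x, A(G)x⟩ : x ∈ ℝ^V, ‖x‖ = 1, Σ_{v∈V} x_v = 0 } be its second-largest adjacency eigenvalue. Then (1/2)(d − λ₂(G)) ≤ h(G) ≤ √(2d(d − λ₂(G))). -/

import Mathlib

open Finset

/-- `|E(U, V∖U)|`: the number of edges of `G` with one endpoint in `U` and the other
outside `U`, counted via ordered pairs `(u, w)` with `u ∈ U`, `w ∉ U`, `u ~ w`. -/
noncomputable def edgeBoundaryCount {V : Type} (G : SimpleGraph V) (U : Set V) : ℕ :=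
  Set.ncard { p : V × V | p.1 ∈ U ∧ p.2 ∉ U ∧ G.Adj p.1 p.2 }

/-- The expansion (Cheeger) constant
`h(G) = min { |E(U, V∖U)| / min(|U|, |V∖U|) : ∅ ⊊ U ⊊ V }`. -/
noncomputable def cheegerConstant {V : Type} [Fintype V] (G : SimpleGraph V) : ℝ :=
  sInf { r : ℝ | ∃ U : Set V, U.Nonempty ∧ U ≠ Set.univ ∧
    r = (edgeBoundaryCount G U : ℝ) / min (U.ncard : ℝ) ((Uᶜ : Set V).ncard : ℝ) }

/-- The second-largest adjacency eigenvalue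
`λ₂(G) = max { ⟨x, A(G) x⟩ : ‖x‖ = 1, ∑ v x_v = 0 }`. -/
noncomputable def lambdaTwoGraph {V : Type} [Fintype V] (G : SimpleGraph V)
    [DecidableRel G.Adj] : ℝ :=
  sSup { r : ℝ | ∃ x : V → ℝ, ∑ v, x v ^ 2 = 1 ∧ ∑ v, x v = 0 ∧
    r = ∑ v, x v * (G.adjMatrix ℝ).mulVec x v }

theorem adjMatrix_entry_nonneg {V : Type} (G : SimpleGraph V) [DecidableRel G.Adj]
    (u v : V) : 0 ≤ G.adjMatrix ℝ u v := by
  rw [SimpleGraph.adjMatrix_apply]; split_ifs <;> norm_num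

theorem adjMatrix_entry_comm {V : Type} (G : SimpleGraph V) [DecidableRel G.Adj]
    (u v : V) : G.adjMatrix ℝ u v = G.adjMatrix ℝ v u := by
  simp only [SimpleGraph.adjMatrix_apply, G.adj_comm]

theorem sq_posPart_sub_add_sq_negPart_sub_le (a b : ℝ) :
    (max a 0 - max b 0) ^ 2 + (max (-a) 0 - max (-b) 0) ^ 2 ≤ (a - b) ^ 2 := by
  rcases le_total a 0 with ha | ha <;> rcases le_total b 0 with hb | hb <;>
    simp [ha, hb] <;> nlinarith

theorem exists_median {V : Type} [Fintype V] [Nonempty V] (x : V → ℝ) :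
    ∃ m : ℝ, 2 * #{v | m < x v} ≤ Fintype.card V ∧ 2 * #{v | x v < m} ≤ Fintype.card V := by
  obtain ⟨top, -, htop⟩ := univ.exists_max_image x univ_nonempty
  let T : Finset V := {w | 2 * #{v | x w < x v} ≤ Fintype.card V}
  have hT : T.Nonempty := ⟨top, by
    have : ({v | x top < x v} : Finset V) = ∅ :=
      filter_eq_empty_iff.2 fun v hv => not_lt.2 (htop v hv)
    simp [T, this]⟩
  obtain ⟨w, hwT, hw⟩ := T.exists_min_image x hT
  refine ⟨x w, (mem_filter.1 hwT).2, ?_⟩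
  by_contra! hlt
  have hne : ({v | x v < x w} : Finset V).Nonempty := card_pos.1 (by omega)
  obtain ⟨t, ht, htmax⟩ := exists_max_image _ x hne
  have htw : x t < x w := (mem_filter.1 ht).2
  have hsub : ({v | x t < x v} : Finset V) ⊆ ({v | ¬ x v < x w} : Finset V) := fun v hv => by
    refine mem_filter.2 ⟨mem_univ v, fun hvw => ?_⟩
    exact absurd (htmax v (mem_filter.2 ⟨mem_univ v, hvw⟩)) (not_le.2 (mem_filter.1 hv).2)
  have hcard := card_le_card hsub
  have htot := card_filter_add_card_filter_not (s := univ) (fun v => x v < x w)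
  rw [card_univ] at htot
  have htT : t ∈ T := mem_filter.2 ⟨mem_univ t, by omega⟩
  exact absurd (hw t htT) (not_le.2 htw)

section DirichletForm

variable {V : Type} [Fintype V] (G : SimpleGraph V) [DecidableRel G.Adj]

/-- The Dirichlet form `∑ (x u - x v)²`, summed over ordered pairs of adjacent vertices. -/
noncomputable def dirichletForm (x : V → ℝ) : ℝ :=
  ∑ u, ∑ v, G.adjMatrix ℝ u v * (x u - x v) ^ 2

theorem dirichletForm_nonneg (x : V → ℝ) : 0 ≤ dirichletForm G x :=
  sum_nonneg fun u _ => sum_nonneg fun v _ =>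
    mul_nonneg (adjMatrix_entry_nonneg G u v) (sq_nonneg _)

theorem sum_adjMatrix_row {d : ℕ} (hreg : G.IsRegularOfDegree d) (u : V) :
    ∑ v, G.adjMatrix ℝ u v = d := by
  simp [SimpleGraph.adjMatrix_apply, ← hreg u, ← G.card_neighborFinset_eq_degree,
    SimpleGraph.neighborFinset_eq_filter]

theorem sum_sum_adjMatrix_mul_left {d : ℕ} (hreg : G.IsRegularOfDegree d) (φ : V → ℝ) :
    ∑ u, ∑ v, G.adjMatrix ℝ u v * φ u = d * ∑ u, φ u := by
  simp only [← sum_mul, sum_adjMatrix_row G hreg, mul_sum]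

theorem sum_sum_adjMatrix_mul_right {d : ℕ} (hreg : G.IsRegularOfDegree d) (φ : V → ℝ) :
    ∑ u, ∑ v, G.adjMatrix ℝ u v * φ v = d * ∑ u, φ u := by
  rw [sum_comm, ← sum_sum_adjMatrix_mul_left G hreg]
  simp only [fun u v => adjMatrix_entry_comm G u v]

theorem dirichletForm_eq {d : ℕ} (hreg : G.IsRegularOfDegree d) (x : V → ℝ) :
    dirichletForm G x =
      2 * (d * ∑ v, x v ^ 2 - ∑ v, x v * (G.adjMatrix ℝ).mulVec x v) := by
  have hl := sum_sum_adjMatrix_mul_left G hreg (fun v => x v ^ 2)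
  have hr := sum_sum_adjMatrix_mul_right G hreg (fun v => x v ^ 2)
  have hq : ∑ v, x v * (G.adjMatrix ℝ).mulVec x v =
      ∑ u, ∑ v, G.adjMatrix ℝ u v * (x u * x v) := by
    simp only [Matrix.mulVec, dotProduct, mul_sum]
    exact sum_congr rfl fun u _ => sum_congr rfl fun v _ => by ring
  have hexp : dirichletForm G x = ∑ u, ∑ v, G.adjMatrix ℝ u v * x u ^ 2 +
      ∑ u, ∑ v, G.adjMatrix ℝ u v * x v ^ 2 -
      2 * ∑ u, ∑ v, G.adjMatrix ℝ u v * (x u * x v) := by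
    simp only [dirichletForm, mul_sum, ← sum_add_distrib, ← sum_sub_distrib]
    exact sum_congr rfl fun u _ => sum_congr rfl fun v _ => by ring
  rw [hexp, hl, hr, hq]; ring

theorem bddAbove_rayleigh {d : ℕ} (hreg : G.IsRegularOfDegree d) :
    BddAbove { r : ℝ | ∃ x : V → ℝ, ∑ v, x v ^ 2 = 1 ∧ ∑ v, x v = 0 ∧
      r = ∑ v, x v * (G.adjMatrix ℝ).mulVec x v } := by
  refine ⟨d, ?_⟩
  rintro r ⟨x, hx, -, rfl⟩
  have h1 := dirichletForm_eq G hreg x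
  have h2 := dirichletForm_nonneg G x
  rw [hx] at h1
  linarith

theorem dirichletForm_smul (c : ℝ) (x : V → ℝ) :
    dirichletForm G (fun v => c * x v) = c ^ 2 * dirichletForm G x := by
  simp only [dirichletForm, mul_sum]
  exact sum_congr rfl fun u _ => sum_congr rfl fun v _ => by ring

theorem spectralGap_mul_le_dirichletForm {d : ℕ} (hreg : G.IsRegularOfDegree d) (x : V → ℝ)
    (hx : ∑ v, x v = 0) (hpos : 0 < ∑ v, x v ^ 2) :
    2 * (((d : ℝ) - lambdaTwoGraph G) * ∑ v, x v ^ 2) ≤ dirichletForm G x := by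
  set s := ∑ v, x v ^ 2 with hs
  have hc : (√s)⁻¹ ^ 2 = s⁻¹ := by rw [inv_pow, Real.sq_sqrt hpos.le]
  have hn : ∑ v, ((√s)⁻¹ * x v) ^ 2 = 1 := by
    simp only [mul_pow, ← mul_sum, hc, ← hs]
    exact inv_mul_cancel₀ hpos.ne'
  have hle := le_csSup (bddAbove_rayleigh G hreg)
    ⟨fun v => (√s)⁻¹ * x v, hn, by rw [← mul_sum, hx, mul_zero], rfl⟩
  have hD := dirichletForm_eq G hreg (fun v => (√s)⁻¹ * x v)
  rw [dirichletForm_smul, hn, hc] at hD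
  have hgap : 2 * ((d : ℝ) - lambdaTwoGraph G) ≤ s⁻¹ * dirichletForm G x := by
    rw [hD]; unfold lambdaTwoGraph; linarith
  calc 2 * (((d : ℝ) - lambdaTwoGraph G) * s)
      = 2 * ((d : ℝ) - lambdaTwoGraph G) * s := by ring
    _ ≤ s⁻¹ * dirichletForm G x * s := mul_le_mul_of_nonneg_right hgap hpos.le
    _ = dirichletForm G x := by field_simp

theorem dirichletForm_sub_const (x : V → ℝ) (m : ℝ) :
    dirichletForm G (fun v => x v - m) = dirichletForm G x := by
  simp only [dirichletForm, sub_sub_sub_cancel_right]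

theorem dirichletForm_posPart_add_negPart_le (g : V → ℝ) :
    dirichletForm G (fun v => max (g v) 0) + dirichletForm G (fun v => max (-g v) 0) ≤
      dirichletForm G g := by
  simp only [dirichletForm, ← sum_add_distrib, ← mul_add]
  exact sum_le_sum fun u _ => sum_le_sum fun v _ =>
    mul_le_mul_of_nonneg_left (sq_posPart_sub_add_sq_negPart_sub_le _ _)
      (adjMatrix_entry_nonneg G u v)

end DirichletForm

section Cheeger

variable {V : Type} [Fintype V] (G : SimpleGraph V)

theorem cheegerConstant_nonneg : 0 ≤ cheegerConstant G := by
  refine Real.sInf_nonneg ?_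
  rintro r ⟨U, -, -, rfl⟩
  positivity

variable [DecidableEq V]

theorem cheegerConstant_mul_card_le (S : Finset V) (hS : 2 * #S ≤ Fintype.card V) :
    cheegerConstant G * #S ≤ edgeBoundaryCount G (S : Set V) := by
  rcases S.eq_empty_or_nonempty with rfl | hne
  · simp
  have hpos : 0 < #S := hne.card_pos
  have hcompl : ((S : Set V)ᶜ).ncard = Fintype.card V - #S := by
    rw [← coe_compl, Set.ncard_coe_finset, card_compl]
  have hmin : min ((S : Set V).ncard : ℝ) (((S : Set V)ᶜ).ncard : ℝ) = #S := by
    rw [hcompl, Set.ncard_coe_finset, min_eq_left]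
    exact_mod_cast (by omega : #S ≤ Fintype.card V - #S)
  have hle : cheegerConstant G ≤ (edgeBoundaryCount G (S : Set V) : ℝ) / #S := by
    refine csInf_le ⟨0, ?_⟩ ⟨S, by simpa using hne, ?_, by rw [hmin]⟩
    · rintro r ⟨U, -, -, rfl⟩
      positivity
    · intro h
      rw [coe_eq_univ] at h
      rw [h, card_univ] at hS hpos
      omega
  rwa [le_div_iff₀ (by exact_mod_cast hpos)] at hle

variable [DecidableRel G.Adj]

theorem edgeBoundaryCount_eq_sum (S : Finset V) :
    (edgeBoundaryCount G (S : Set V) : ℝ) =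
      ∑ u, ∑ v, G.adjMatrix ℝ u v * if u ∈ S ∧ v ∉ S then 1 else 0 := by
  have h : { p : V × V | p.1 ∈ (S : Set V) ∧ p.2 ∉ (S : Set V) ∧ G.Adj p.1 p.2 } =
      ((univ.filter fun p : V × V => G.Adj p.1 p.2 ∧ p.1 ∈ S ∧ p.2 ∉ S : Finset (V × V)) :
        Set (V × V)) := by
    ext p; simp; tauto
  rw [edgeBoundaryCount, h, Set.ncard_coe_finset, card_filter, Nat.cast_sum,
    ← univ_product_univ, sum_product]
  refine sum_congr rfl fun u _ => sum_congr rfl fun v _ => ?_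
  simp only [SimpleGraph.adjMatrix_apply]
  split_ifs <;> simp_all

theorem two_mul_edgeBoundaryCount (S : Finset V) :
    2 * (edgeBoundaryCount G (S : Set V) : ℝ) =
      ∑ u, ∑ v, G.adjMatrix ℝ u v *
        |(if u ∈ S then (1 : ℝ) else 0) - if v ∈ S then 1 else 0| := by
  have h := edgeBoundaryCount_eq_sum G S
  have h' := h
  rw [sum_comm] at h'
  rw [two_mul]
  nth_rw 1 [h]
  rw [h']
  simp only [← sum_add_distrib]
  refine sum_congr rfl fun u _ => sum_congr rfl fun v _ => ?_
  rw [adjMatrix_entry_comm G v u, ← mul_add]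
  by_cases hu : u ∈ S <;> by_cases hv : v ∈ S <;> simp [hu, hv]

theorem spectralGap_mul_card_mul_card_compl_le {d : ℕ} (hreg : G.IsRegularOfDegree d) (S : Finset V)
    (hS : S.Nonempty) (hS' : Sᶜ.Nonempty) :
    ((d : ℝ) - lambdaTwoGraph G) * (#S * #Sᶜ) ≤
      (#S + #Sᶜ) * edgeBoundaryCount G (S : Set V) := by
  have ha : (0 : ℝ) < #S := by exact_mod_cast hS.card_pos
  have hb : (0 : ℝ) < #Sᶜ := by exact_mod_cast hS'.card_pos
  set a : ℝ := (#S : ℝ)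
  set b : ℝ := (#Sᶜ : ℝ)
  let y : V → ℝ := fun v => if v ∈ S then b else -a
  have hsum (p q : ℝ) : ∑ v, (if v ∈ S then p else q) = a * p + b * q := by
    rw [sum_ite, sum_const, sum_const, nsmul_eq_mul, nsmul_eq_mul, filter_mem_eq_inter,
      univ_inter, filter_not, filter_mem_eq_inter, univ_inter, ← compl_eq_univ_sdiff]
  have hy0 : ∑ v, y v = 0 := by rw [hsum]; ring
  have hy2 : ∑ v, y v ^ 2 = (a + b) * (a * b) := by
    have : ∀ v, y v ^ 2 = if v ∈ S then b ^ 2 else a ^ 2 := fun v => by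
      simp only [y]; split_ifs <;> ring
    simp only [this, hsum]; ring
  have hD : dirichletForm G y = (a + b) ^ 2 * (2 * edgeBoundaryCount G (S : Set V)) := by
    rw [two_mul_edgeBoundaryCount, dirichletForm, mul_sum]
    refine sum_congr rfl fun u _ => ?_
    rw [mul_sum]
    refine sum_congr rfl fun v _ => ?_
    simp only [y]
    by_cases hu : u ∈ S <;> by_cases hv : v ∈ S <;> simp [hu, hv] <;> ring_nf
  have h := spectralGap_mul_le_dirichletForm G hreg y hy0 (by rw [hy2]; positivity)
  rw [hy2, hD] at h
  refine le_of_mul_le_mul_left (?_ : 2 * (a + b) * _ ≤ 2 * (a + b) * _) (by positivity)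
  linarith

/-- A discrete co-area inequality. -/
theorem cheegerConstant_mul_sum_le (φ : V → ℝ) (hφ : ∀ v, 0 ≤ φ v)
    (hsupp : 2 * #{v | φ v ≠ 0} ≤ Fintype.card V) :
    2 * (cheegerConstant G * ∑ v, φ v) ≤
      ∑ u, ∑ v, G.adjMatrix ℝ u v * |φ u - φ v| := by
  induction hk : #{v | φ v ≠ 0} using Nat.strong_induction_on generalizing φ with
  | _ k ih =>
  set S : Finset V := {v | φ v ≠ 0} with hS
  have hmem (v : V) : v ∈ S ↔ φ v ≠ 0 := by simp [hS]
  rcases S.eq_empty_or_nonempty with hemp | hne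
  · have hz : ∀ v, φ v = 0 := fun v => by
      by_contra h
      simpa [hemp] using (hmem v).2 h
    simp [hz]
  obtain ⟨w, hwS, hw⟩ := S.exists_min_image φ hne
  let ψ : V → ℝ := fun v => φ v - φ w * if v ∈ S then 1 else 0
  have hψ : ∀ v, 0 ≤ ψ v := fun v => by
    by_cases hv : v ∈ S
    · simpa [ψ, hv] using hw v hv
    · simpa [ψ, hv] using hφ v
  have hlt : #{v | ψ v ≠ 0} < #S := by
    refine card_lt_card (Finset.ssubset_iff_subset_ne.2 ⟨fun v hv => ?_, fun h => ?_⟩)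
    · by_contra hvS
      have h0 : φ v = 0 := by simpa [hmem] using hvS
      simp [ψ, hvS, h0] at hv
    · rw [← h] at hwS
      have hwS' : w ∈ S := h ▸ hwS
      simp [ψ, hwS'] at hwS
  have hind := ih _ (hk ▸ hlt) ψ hψ (by omega) rfl
  have hcut := cheegerConstant_mul_card_le G S hsupp
  have hsum : ∑ v, φ v = ∑ v, ψ v + φ w * #S := by
    simp [ψ, sum_sub_distrib, mul_comm]
  have habs : ∑ u, ∑ v, G.adjMatrix ℝ u v * |φ u - φ v| =
      ∑ u, ∑ v, G.adjMatrix ℝ u v * |ψ u - ψ v| +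
        φ w * (2 * edgeBoundaryCount G (S : Set V)) := by
    rw [two_mul_edgeBoundaryCount, mul_sum, ← sum_add_distrib]
    refine sum_congr rfl fun u _ => ?_
    rw [mul_sum, ← sum_add_distrib]
    refine sum_congr rfl fun v _ => ?_
    rw [mul_left_comm, ← mul_add]
    congr 1
    have hφS : ∀ v, v ∉ S → φ v = 0 := fun v hv => by simpa [hmem] using hv
    by_cases hu : u ∈ S <;> by_cases hv : v ∈ S
    · simp [ψ, hu, hv]
    · have := hw u hu
      simp [ψ, hu, hv, hφS v hv, abs_of_nonneg (hφ u), abs_of_nonneg (sub_nonneg.2 this)]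
    · have := hw v hv
      simp [ψ, hu, hv, hφS u hu, abs_of_nonneg (hφ v), abs_of_nonpos (sub_nonpos.2 this)]
    · simp [ψ, hu, hv]
  rw [hsum, habs]
  nlinarith [mul_le_mul_of_nonneg_left hcut (hφ w)]

theorem cheegerConstant_sq_mul_sum_sq_le {d : ℕ} (hreg : G.IsRegularOfDegree d) (f : V → ℝ)
    (hsupp : 2 * #{v | f v ≠ 0} ≤ Fintype.card V) :
    cheegerConstant G ^ 2 * ∑ v, f v ^ 2 ≤ d * dirichletForm G f := by
  have hh := cheegerConstant_nonneg G
  have hD := dirichletForm_nonneg G f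
  rcases (sum_nonneg fun v _ => sq_nonneg (f v) : 0 ≤ ∑ v, f v ^ 2).eq_or_lt with h0 | hpos
  · rw [← h0, mul_zero]; positivity
  set s := ∑ v, f v ^ 2 with hs
  have hcoarea := cheegerConstant_mul_sum_le G (fun v => f v ^ 2) (fun v => sq_nonneg _)
    (by simpa using hsupp)
  have hplus : ∑ u, ∑ v, G.adjMatrix ℝ u v * (f u + f v) ^ 2 ≤ 4 * d * s := by
    have hl := sum_sum_adjMatrix_mul_left G hreg (fun v => f v ^ 2)
    have hr := sum_sum_adjMatrix_mul_right G hreg (fun v => f v ^ 2)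
    calc ∑ u, ∑ v, G.adjMatrix ℝ u v * (f u + f v) ^ 2
        ≤ ∑ u, ∑ v, 2 * (G.adjMatrix ℝ u v * f u ^ 2 + G.adjMatrix ℝ u v * f v ^ 2) := by
          refine sum_le_sum fun u _ => sum_le_sum fun v _ => ?_
          nlinarith [mul_nonneg (adjMatrix_entry_nonneg G u v) (sq_nonneg (f u - f v))]
      _ = 4 * d * s := by
          simp only [← mul_sum, sum_add_distrib, hl, hr]; ring
  have hCS : (∑ u, ∑ v, G.adjMatrix ℝ u v * |f u ^ 2 - f v ^ 2|) ^ 2 ≤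
      dirichletForm G f * ∑ u, ∑ v, G.adjMatrix ℝ u v * (f u + f v) ^ 2 := by
    simp only [dirichletForm, ← sum_product']
    refine sum_sq_le_sum_mul_sum_of_sq_le_mul _
      (fun p _ => mul_nonneg (adjMatrix_entry_nonneg G _ _) (sq_nonneg _))
      (fun p _ => mul_nonneg (adjMatrix_entry_nonneg G _ _) (sq_nonneg _)) fun p _ => le_of_eq ?_
    rw [mul_pow, sq_abs]; ring
  have hsq : (2 * (cheegerConstant G * s)) ^ 2 ≤ dirichletForm G f * (4 * d * s) :=
    (pow_le_pow_left₀ (by positivity) hcoarea 2).trans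
      (hCS.trans (mul_le_mul_of_nonneg_left hplus hD))
  refine le_of_mul_le_mul_left (?_ : 4 * s * _ ≤ 4 * s * _) (by positivity)
  linarith

theorem cheegerConstant_sq_le_dirichletForm [Nonempty V] {d : ℕ}
    (hreg : G.IsRegularOfDegree d) (x : V → ℝ) (hx0 : ∑ v, x v = 0) :
    cheegerConstant G ^ 2 * ∑ v, x v ^ 2 ≤ d * dirichletForm G x := by
  obtain ⟨m, hm1, hm2⟩ := exists_median x
  have hp := cheegerConstant_sq_mul_sum_sq_le G hreg (fun v => max (x v - m) 0)
    (by simpa using hm1)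
  have hn := cheegerConstant_sq_mul_sum_sq_le G hreg (fun v => max (-(x v - m)) 0)
    (by simpa using hm2)
  have hsplit := dirichletForm_posPart_add_negPart_le G (fun v => x v - m)
  rw [dirichletForm_sub_const] at hsplit
  have hsum : ∑ v, x v ^ 2 ≤
      ∑ v, max (x v - m) 0 ^ 2 + ∑ v, max (-(x v - m)) 0 ^ 2 := by
    calc ∑ v, x v ^ 2 ≤ ∑ v, x v ^ 2 - 2 * m * ∑ v, x v + ∑ _v : V, m ^ 2 := by
          rw [hx0]; have : 0 ≤ ∑ _v : V, m ^ 2 := by positivity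
          linarith
      _ = ∑ v, max (x v - m) 0 ^ 2 + ∑ v, max (-(x v - m)) 0 ^ 2 := by
          rw [mul_sum, ← sum_sub_distrib, ← sum_add_distrib, ← sum_add_distrib]
          refine sum_congr rfl fun v _ => ?_
          rcases le_total (x v - m) 0 with h | h
          · rw [max_eq_right h, max_eq_left (neg_nonneg.2 h)]; ring
          · rw [max_eq_left h, max_eq_right (neg_nonpos.2 h)]; ring
  have h1 := mul_le_mul_of_nonneg_left hsum (sq_nonneg (cheegerConstant G))
  have h2 := mul_le_mul_of_nonneg_left hsplit (Nat.cast_nonneg (α := ℝ) d)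
  linarith

theorem exists_unit_vector_sum_eq_zero (hV : 2 ≤ Fintype.card V) :
    ∃ x : V → ℝ, ∑ v, x v ^ 2 = 1 ∧ ∑ v, x v = 0 := by
  obtain ⟨a, b, hab⟩ := Fintype.exists_pair_of_one_lt_card hV
  refine ⟨fun v => (√2)⁻¹ * ((if v = a then 1 else 0) - if v = b then 1 else 0), ?_, ?_⟩
  · have : ∀ v, ((√2)⁻¹ * ((if v = a then (1 : ℝ) else 0) - if v = b then 1 else 0)) ^ 2 =
        2⁻¹ * ((if v = a then 1 else 0) + if v = b then 1 else 0) := fun v => by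
      rw [mul_pow, inv_pow, Real.sq_sqrt zero_le_two]
      by_cases ha : v = a
      · simp [ha, hab]
      · by_cases hb : v = b <;> simp [ha, hb, hab.symm]
    simp only [this, ← mul_sum, sum_add_distrib, sum_ite_eq', mem_univ, if_true]
    norm_num
  · simp [← mul_sum, sum_sub_distrib]

end Cheeger

/-- the discrete Cheeger inequalities
`(1/2)(d − λ₂(G)) ≤ h(G) ≤ √(2d(d − λ₂(G)))` for a connected `d`-regular finite
simple graph `G` on at least two vertices. -/
theorem stmt2 {V : Type} [Fintype V] [DecidableEq V] (G : SimpleGraph V)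
    [DecidableRel G.Adj]
    (hV : 2 ≤ Fintype.card V) (hconn : G.Connected)
    (d : ℕ) (hreg : G.IsRegularOfDegree d) :
    (1 / 2 : ℝ) * ((d : ℝ) - lambdaTwoGraph G) ≤ cheegerConstant G ∧
    cheegerConstant G ≤ Real.sqrt (2 * (d : ℝ) * ((d : ℝ) - lambdaTwoGraph G)) := by
  have : Nonempty V := hconn.nonempty
  obtain ⟨x₀, hx₀, hx₀'⟩ := exists_unit_vector_sum_eq_zero hV
  constructor
  · refine le_csInf ?_ ?_
    · obtain ⟨a, b, hab⟩ := Fintype.exists_pair_of_one_lt_card hV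
      exact ⟨_, {a}, Set.singleton_nonempty a, fun h => hab.symm (h ▸ Set.mem_univ b : b ∈ {a}),
        rfl⟩
    · rintro r ⟨U, hU, hU', rfl⟩
      obtain ⟨S, rfl⟩ : ∃ S : Finset V, (S : Set V) = U := ⟨U.toFinite.toFinset, by simp⟩
      have hS : S.Nonempty := by simpa using hU
      have hS' : Sᶜ.Nonempty := by
        rw [nonempty_iff_ne_empty, ne_eq, compl_eq_empty_iff]
        simpa using hU'
      have h := spectralGap_mul_card_mul_card_compl_le G hreg S hS hS'
      rw [← coe_compl, Set.ncard_coe_finset, Set.ncard_coe_finset]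
      have ha : (0 : ℝ) < #S := by exact_mod_cast hS.card_pos
      have hb : (0 : ℝ) < #Sᶜ := by exact_mod_cast hS'.card_pos
      have he : (0 : ℝ) ≤ edgeBoundaryCount G (S : Set V) := Nat.cast_nonneg _
      generalize (#S : ℝ) = a at *
      generalize (#Sᶜ : ℝ) = b at *
      rw [le_div_iff₀ (lt_min ha hb)]
      rcases le_total a b with hab | hab
      · rw [min_eq_left hab]
        refine le_of_mul_le_mul_left (?_ : 2 * b * _ ≤ 2 * b * _) (by positivity)
        nlinarith
      · rw [min_eq_right hab]
        refine le_of_mul_le_mul_left (?_ : 2 * a * _ ≤ 2 * a * _) (by positivity)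
        nlinarith
  · have key : ∀ x : V → ℝ, ∑ v, x v ^ 2 = 1 → ∑ v, x v = 0 →
        cheegerConstant G ^ 2 ≤ 2 * d * (d - ∑ v, x v * (G.adjMatrix ℝ).mulVec x v) := by
      intro x hx hx'
      have h := cheegerConstant_sq_le_dirichletForm G hreg x hx'
      rw [dirichletForm_eq G hreg, hx] at h
      linarith
    refine Real.le_sqrt_of_sq_le ?_
    rcases (Nat.cast_nonneg d : (0 : ℝ) ≤ d).eq_or_lt with hd | hd
    · have h := key x₀ hx₀ hx₀'
      rw [← hd] at h ⊢
      linarith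
    · have hle : lambdaTwoGraph G ≤ d - cheegerConstant G ^ 2 / (2 * d) := by
        refine csSup_le ⟨_, x₀, hx₀, hx₀', rfl⟩ ?_
        rintro r ⟨x, hx, hx', rfl⟩
        have h := key x hx hx'
        rw [mul_comm, ← div_le_iff₀ (by positivity)] at h
        linarith
      rw [mul_comm, ← div_le_iff₀ (by positivity)]
      linarith
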